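/- Let (Ω, F, P) be a probability space, H ⊆ F a sub-σ-algebra, Y : Ω → ℝ^k a random vector whose law is the standard Gaussian on ℝ^k and which is independent of H, Z : Ω → ℝ^k an H-measurable random vector, and D an invertible k×k real matrix. Set Λ := φ_k(D^{−1}(Y − Z)) / (|det D| · φ_k(Y)) and Q := P.withDensity Λ. Then: (i) Q is a probability measure; (ii) Q agrees with P on H, i.e. Q(A) = P(A) for every A ∈ H; (iii) under Q the random vector D^{−1}(Y − Z) has the standard Gaussian law on ℝ^k; and (iv) D^{−1}(Y − Z) is independent of H under Q. -/

import Mathlib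

open MeasureTheory ProbabilityTheory

/-- The standard Gaussian density `φ_k(z) = (2π)^{-k/2} exp(-‖z‖²/2)` on `ℝ^k`. -/
noncomputable def gaussDensity (m : ℕ) (z : Fin m → ℝ) : ℝ :=
  (2 * Real.pi) ^ (-(m : ℝ) / 2) * Real.exp (-(∑ i, z i ^ 2) / 2)

/-- The standard Gaussian law on `ℝ^k`: the `k`-fold product of `gaussianReal 0 1`. -/
noncomputable def stdGaussianPi (m : ℕ) : Measure (Fin m → ℝ) :=
  Measure.pi fun _ => gaussianReal 0 1

theorem gaussDensity_eq_prod (m : ℕ) (z : Fin m → ℝ) :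
    gaussDensity m z = ∏ i, gaussianPDFReal 0 1 (z i) := by
  simp only [gaussDensity, gaussianPDFReal, Finset.prod_mul_distrib, Finset.prod_const,
    Finset.card_univ, Fintype.card_fin, ← Real.exp_sum, NNReal.coe_one, mul_one, sub_zero]
  congr 1
  · rw [Real.sqrt_eq_rpow, ← Real.rpow_neg (by positivity), ← Real.rpow_natCast,
      ← Real.rpow_mul (by positivity)]
    congr 1
    ring
  · rw [← Finset.sum_div, Finset.sum_neg_distrib]

theorem gaussDensity_pos (m : ℕ) (z : Fin m → ℝ) : 0 < gaussDensity m z := by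
  unfold gaussDensity; positivity

theorem measurable_gaussDensity (m : ℕ) : Measurable (gaussDensity m) := by
  unfold gaussDensity; fun_prop

theorem stdGaussianPi_eq (m : ℕ) :
    stdGaussianPi m = volume.withDensity fun z => ENNReal.ofReal (gaussDensity m z) := by
  refine Measure.pi_eq fun s hs => ?_
  rw [withDensity_apply _ (MeasurableSet.univ_pi hs), volume_pi, Measure.restrict_pi_pi]
  simp_rw [gaussDensity_eq_prod]
  have hint : ∀ i, Integrable (gaussianPDFReal 0 1) ((volume : Measure ℝ).restrict (s i)) :=
    fun i => (integrable_gaussianPDFReal 0 1).restrict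
  rw [← ofReal_integral_eq_lintegral_ofReal
      (Integrable.fintype_prod (f := fun _ => gaussianPDFReal 0 1) hint)
      (Filter.Eventually.of_forall fun z => Finset.prod_nonneg fun i _ =>
        gaussianPDFReal_nonneg 0 1 (z i)),
    integral_fintype_prod_eq_prod (f := fun _ => gaussianPDFReal 0 1),
    ENNReal.ofReal_prod_of_nonneg
      (fun i _ => integral_nonneg fun x => gaussianPDFReal_nonneg 0 1 x)]
  exact Finset.prod_congr rfl fun i _ =>
    (gaussianReal_apply_eq_integral 0 one_ne_zero (s i)).symm

theorem inner_girsanov {k : ℕ} (D : Matrix (Fin k) (Fin k) ℝ) (hD : IsUnit D.det)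
    (c : Fin k → ℝ) (E : Set (Fin k → ℝ)) (hE : MeasurableSet E) :
    ∫⁻ y, E.indicator 1 (D⁻¹.mulVec (y - c)) *
      ENNReal.ofReal (gaussDensity k (D⁻¹.mulVec (y - c)) / (|D.det| * gaussDensity k y))
        ∂(stdGaussianPi k) = stdGaussianPi k E := by
  have hd : D.det ≠ 0 := hD.ne_zero
  have hd' : D⁻¹.det ≠ 0 := by
    rw [Matrix.det_nonsing_inv, Ring.inverse_eq_inv']; exact inv_ne_zero hd
  have hmul : Measurable fun y : Fin k → ℝ => D⁻¹.mulVec y :=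
    (Matrix.mulVecLin D⁻¹).continuous_of_finiteDimensional.measurable
  have hsub : Measurable fun y : Fin k → ℝ => D⁻¹.mulVec (y - c) :=
    hmul.comp (measurable_id.sub_const c)
  have hφ := measurable_gaussDensity k
  have hind : Measurable (E.indicator (1 : (Fin k → ℝ) → ENNReal)) :=
    measurable_one.indicator hE
  let G : (Fin k → ℝ) → ENNReal := fun x =>
    E.indicator 1 x * ENNReal.ofReal (gaussDensity k x)
  have hG : Measurable G := hind.mul hφ.ennreal_ofReal
  have hmap : Measure.map (fun y : Fin k → ℝ => D⁻¹.mulVec y) volume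
      = ENNReal.ofReal |D.det| • volume := by
    have := Real.map_matrix_volume_pi_eq_smul_volume_pi hd'
    rw [Matrix.det_nonsing_inv, Ring.inverse_eq_inv', inv_inv] at this
    exact this
  have hF : Measurable fun y : Fin k → ℝ =>
      E.indicator (1 : (Fin k → ℝ) → ENNReal) (D⁻¹.mulVec (y - c)) *
      ENNReal.ofReal (gaussDensity k (D⁻¹.mulVec (y - c)) / (|D.det| * gaussDensity k y)) :=
    (hind.comp hsub).mul ((hφ.comp hsub).div (hφ.const_mul _)).ennreal_ofReal
  rw [stdGaussianPi_eq, lintegral_withDensity_eq_lintegral_mul _ hφ.ennreal_ofReal hF]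
  calc _ = ∫⁻ y, (ENNReal.ofReal |D.det|)⁻¹ * G (D⁻¹.mulVec (y - c)) := by
        refine lintegral_congr fun y => ?_
        have h1 := gaussDensity_pos k y
        have h2 : 0 < |D.det| := abs_pos.mpr hd
        simp only [Pi.mul_apply, G]
        rw [← ENNReal.ofReal_inv_of_pos h2, mul_left_comm,
          mul_left_comm (ENNReal.ofReal |D.det|⁻¹), ← ENNReal.ofReal_mul h1.le,
          ← ENNReal.ofReal_mul (by positivity)]
        congr 2
        field_simp
    _ = (ENNReal.ofReal |D.det|)⁻¹ * ∫⁻ y, G (D⁻¹.mulVec y) := by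
        have hGs : Measurable fun y : Fin k → ℝ => G (D⁻¹.mulVec (y - c)) := hG.comp hsub
        rw [lintegral_const_mul _ hGs,
          lintegral_sub_right_eq_self (fun y => G (D⁻¹.mulVec y)) c]
    _ = ∫⁻ x, G x := by
        rw [← lintegral_map hG hmul, hmap, lintegral_smul_measure, smul_eq_mul, ← mul_assoc,
          ENNReal.inv_mul_cancel (by simpa using hd) ENNReal.ofReal_ne_top, one_mul]
    _ = _ := by
        rw [withDensity_apply _ hE, ← lintegral_indicator hE]
        refine lintegral_congr fun x => ?_
        by_cases hx : x ∈ E <;> simp [G, hx]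

theorem joint_girsanov {Ω β : Type*} [MeasurableSpace Ω] [MeasurableSpace β]
    (P : Measure Ω) [IsProbabilityMeasure P] {k : ℕ}
    (Y : Ω → Fin k → ℝ) (hY : Measurable Y) (hYlaw : P.map Y = stdGaussianPi k)
    (W : Ω → β) (hW : Measurable W) (hind : IndepFun Y W P)
    (g : β → Fin k → ℝ) (hg : Measurable g)
    (D : Matrix (Fin k) (Fin k) ℝ) (hD : IsUnit D.det)
    (E : Set (Fin k → ℝ)) (hE : MeasurableSet E) (B : Set β) (hB : MeasurableSet B) :
    (P.withDensity fun ω => ENNReal.ofReal (gaussDensity k (D⁻¹.mulVec (Y ω - g (W ω))) /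
        (|D.det| * gaussDensity k (Y ω))))
      ((fun ω => D⁻¹.mulVec (Y ω - g (W ω))) ⁻¹' E ∩ W ⁻¹' B) =
      stdGaussianPi k E * P (W ⁻¹' B) := by
  have hmul : Measurable fun y : Fin k → ℝ => D⁻¹.mulVec y :=
    (Matrix.mulVecLin D⁻¹).continuous_of_finiteDimensional.measurable
  have hφ := measurable_gaussDensity k
  have hsub : Measurable fun p : (Fin k → ℝ) × β => D⁻¹.mulVec (p.1 - g p.2) :=
    hmul.comp (measurable_fst.sub (hg.comp measurable_snd))
  have hYW : Measurable fun ω => (Y ω, W ω) := hY.prodMk hW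
  have hi : Measurable (E.indicator (1 : (Fin k → ℝ) → ENNReal)) :=
    measurable_one.indicator hE
  have hiB : Measurable (B.indicator (1 : β → ENNReal)) := measurable_one.indicator hB
  let F : (Fin k → ℝ) × β → ENNReal := fun p =>
    B.indicator 1 p.2 * (E.indicator 1 (D⁻¹.mulVec (p.1 - g p.2)) *
      ENNReal.ofReal (gaussDensity k (D⁻¹.mulVec (p.1 - g p.2)) /
        (|D.det| * gaussDensity k p.1)))
  have hF0 : Measurable fun p : (Fin k → ℝ) × β =>
      (E.indicator (1 : (Fin k → ℝ) → ENNReal) (D⁻¹.mulVec (p.1 - g p.2)) *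
      ENNReal.ofReal (gaussDensity k (D⁻¹.mulVec (p.1 - g p.2)) /
        (|D.det| * gaussDensity k p.1))) :=
    (hi.comp hsub).mul
      ((hφ.comp hsub).div ((hφ.comp measurable_fst).const_mul _)).ennreal_ofReal
  have hF : Measurable F := (hiB.comp measurable_snd).mul hF0
  have hset : MeasurableSet ((fun ω => D⁻¹.mulVec (Y ω - g (W ω))) ⁻¹' E ∩ W ⁻¹' B) :=
    ((hsub.comp hYW) hE).inter (hW hB)
  have : IsProbabilityMeasure (P.map W) := Measure.isProbabilityMeasure_map hW.aemeasurable
  have : IsProbabilityMeasure (stdGaussianPi k) := by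
    rw [← hYlaw]; exact Measure.isProbabilityMeasure_map hY.aemeasurable
  have hjoint := (indepFun_iff_map_prod_eq_prod_map_map hY.aemeasurable hW.aemeasurable).1 hind
  rw [hYlaw] at hjoint
  rw [withDensity_apply _ hset, ← lintegral_indicator hset]
  calc _ = ∫⁻ ω, F (Y ω, W ω) ∂P := by
        refine lintegral_congr fun ω => ?_
        by_cases h1 : D⁻¹.mulVec (Y ω - g (W ω)) ∈ E <;> by_cases h2 : W ω ∈ B <;>
          simp [F, h1, h2, Set.indicator]
    _ = ∫⁻ p, F p ∂((stdGaussianPi k).prod (P.map W)) := by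
        rw [← hjoint, lintegral_map hF hYW]
    _ = ∫⁻ w, ∫⁻ y, F (y, w) ∂(stdGaussianPi k) ∂(P.map W) :=
        lintegral_prod_symm' _ hF
    _ = ∫⁻ w, B.indicator 1 w * stdGaussianPi k E ∂(P.map W) := by
        refine lintegral_congr fun w => ?_
        have hF1 : Measurable fun y : Fin k → ℝ =>
            E.indicator (1 : (Fin k → ℝ) → ENNReal) (D⁻¹.mulVec (y - g w)) *
            ENNReal.ofReal (gaussDensity k (D⁻¹.mulVec (y - g w)) /
              (|D.det| * gaussDensity k y)) := by
          have hs : Measurable fun y : Fin k → ℝ => D⁻¹.mulVec (y - g w) :=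
            hmul.comp (measurable_id.sub_const (g w))
          exact (hi.comp hs).mul ((hφ.comp hs).div (hφ.const_mul _)).ennreal_ofReal
        simp only [F]
        rw [lintegral_const_mul _ hF1, inner_girsanov D hD _ E hE]
    _ = _ := by
        rw [lintegral_mul_const _ hiB, lintegral_indicator_one hB, Measure.map_apply hW hB,
          mul_comm]



/-- **The one-step discrete-time Girsanov measure transformation.**  If `Y` is
standard Gaussian on `ℝ^k`, independent of the sub-σ-algebra `H`, `Z` is
`H`-measurable, `D` is an invertible `k×k` matrix, and
`Λ := φ_k(D⁻¹(Y − Z)) / (|det D| φ_k(Y))`, `Q := P.withDensity Λ`, then `Q` is a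
probability measure agreeing with `P` on `H`, and under `Q` the random vector
`D⁻¹(Y − Z)` is standard Gaussian and independent of `H`. -/
theorem one_step_girsanov
    {Ω : Type*} {H : MeasurableSpace Ω} [mΩ : MeasurableSpace Ω]
    (P : Measure Ω) [IsProbabilityMeasure P]
    {k : ℕ} (hH : H ≤ mΩ)
    (Y : Ω → Fin k → ℝ) (hYmeas : Measurable Y)
    (hYlaw : P.map Y = stdGaussianPi k)
    (hYindep : Indep (MeasurableSpace.comap Y inferInstance) H P)
    (Z : Ω → Fin k → ℝ) (hZ : Measurable[H] Z)
    (D : Matrix (Fin k) (Fin k) ℝ) (hD : IsUnit D.det)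
    (Λ : Ω → ℝ)
    (hΛ : Λ = fun ω => gaussDensity k (D⁻¹.mulVec (Y ω - Z ω)) /
        (|D.det| * gaussDensity k (Y ω)))
    (Q : Measure Ω)
    (hQ : Q = P.withDensity fun ω => ENNReal.ofReal (Λ ω)) :
    IsProbabilityMeasure Q ∧
    (∀ s : Set Ω, MeasurableSet[H] s → Q s = P s) ∧
    Q.map (fun ω => D⁻¹.mulVec (Y ω - Z ω)) = stdGaussianPi k ∧
    Indep (MeasurableSpace.comap (fun ω => D⁻¹.mulVec (Y ω - Z ω)) inferInstance)
      H Q := by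

  subst hΛ hQ
  have hI : @IndepFun Ω (Fin k → ℝ) Ω mΩ _ H Y id P := by
    refine (@IndepFun_iff_Indep Ω (Fin k → ℝ) Ω mΩ _ H Y id P).2 ?_
    have h : @MeasurableSpace.comap Ω Ω id H = H := MeasurableSpace.comap_id
    rw [h]
    exact hYindep
  have key := fun (E : Set (Fin k → ℝ)) (hE : MeasurableSet E) (B : Set Ω)
      (hB : MeasurableSet[H] B) =>
    @joint_girsanov Ω Ω mΩ H P _ k Y hYmeas hYlaw id (measurable_id'' hH)
      hI
      Z hZ D hD E hE B hB
  simp only [id_eq, Set.preimage_id] at key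
  have hprob : IsProbabilityMeasure (stdGaussianPi k) := by
    rw [← hYlaw]; exact Measure.isProbabilityMeasure_map hYmeas.aemeasurable
  have hX : Measurable fun ω => D⁻¹.mulVec (Y ω - Z ω) :=
    (Matrix.mulVecLin D⁻¹).continuous_of_finiteDimensional.measurable.comp
      (hYmeas.sub (hZ.mono hH le_rfl))
  have hii : ∀ s : Set Ω, MeasurableSet[H] s → (P.withDensity fun ω => ENNReal.ofReal
      (gaussDensity k (D⁻¹.mulVec (Y ω - Z ω)) / (|D.det| * gaussDensity k (Y ω)))) s = P s := by
    intro s hs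
    simpa using key Set.univ MeasurableSet.univ s hs
  have hiii : ∀ E : Set (Fin k → ℝ), MeasurableSet E →
      (P.withDensity fun ω => ENNReal.ofReal
      (gaussDensity k (D⁻¹.mulVec (Y ω - Z ω)) / (|D.det| * gaussDensity k (Y ω))))
      ((fun ω => D⁻¹.mulVec (Y ω - Z ω)) ⁻¹' E) = stdGaussianPi k E := by
    intro E hE
    simpa using key E hE Set.univ (@MeasurableSet.univ _ H)
  refine ⟨⟨?_⟩, hii, ?_, ?_⟩
  · rw [hii _ (@MeasurableSet.univ _ H), measure_univ]
  · ext E hE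
    rw [Measure.map_apply hX hE, hiii E hE]
  · rw [Indep_iff]
    beta_reduce
    rintro _ B ⟨E, hE, rfl⟩ hB
    rw [key E hE B hB, hiii E hE, hii B hB]
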